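/- For {z,z'} = {x,y}, the reduction schema (R5) is valid on k-sight models: [z]K_z z' ↔ (K_z z' ∨ ⋀_{T,T1⊆Cons}(K_z z'=T ∧ Rz=T1 → ⋀_{a∈T1}(D^k a z' ∨ ⋀_{b∈T}(¬ b≡z' → D^k a b)))) holds at every situation of every k-sight model. -/

import Mathlib

/-! Core definitions for the Epistemic Logic of Cops and Robbers (ELCR). -/

/-- The two players/variables. -/
inductive Var : Type
  | x | y
  deriving DecidableEq

/-- The other variable. -/
def Var.other : Var → Var
  | .x => .y
  | .y => .x

/-- Terms: constants or variables. -/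
inductive Term (Cons : Type) : Type
  | const (c : Cons)
  | var (v : Var)
  deriving DecidableEq

/-- Formulas of the full language `L` (with movement modalities). -/
inductive Form (Pred Cons : Type) : Type
  | pred (P : Pred) (args : List (Term Cons))
  | rel (t₁ t₂ : Term Cons)
  | eq (t₁ t₂ : Term Cons)
  | neg (φ : Form Pred Cons)
  | and (φ ψ : Form Pred Cons)
  | Kt (z : Var) (t : Term Cons)
  | K (z : Var) (φ : Form Pred Cons)
  | box (z : Var) (φ : Form Pred Cons)

namespace Form

variable {Pred Cons : Type}

def imp (φ ψ : Form Pred Cons) : Form Pred Cons := .neg (.and φ (.neg ψ))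
def or (φ ψ : Form Pred Cons) : Form Pred Cons := .neg (.and (.neg φ) (.neg ψ))
def iffF (φ ψ : Form Pred Cons) : Form Pred Cons := .and (imp φ ψ) (imp ψ φ)
def falseF : Form Pred Cons := .neg (.eq (.var .x) (.var .x))
def trueF : Form Pred Cons := .neg falseF
/-- `⟨K_z⟩φ := ¬K_z¬φ`. -/
def diaK (z : Var) (φ : Form Pred Cons) : Form Pred Cons := .neg (.K z (.neg φ))

def bigAnd : List (Form Pred Cons) → Form Pred Cons
  | [] => trueF
  | φ :: l => .and φ (bigAnd l)

def bigOr : List (Form Pred Cons) → Form Pred Cons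
  | [] => falseF
  | φ :: l => or φ (bigOr l)

/-- Membership in the Boolean base language `L_B`. -/
def isBase : Form Pred Cons → Prop
  | .pred _ _ => True
  | .rel _ _ => True
  | .eq _ _ => True
  | .neg φ => isBase φ
  | .and φ ψ => isBase φ ∧ isBase ψ
  | .Kt _ _ => False
  | .K _ _ => False
  | .box _ _ => False

/-- Membership in `L_BD` (Booleans plus movement modalities). -/
def isBD : Form Pred Cons → Prop
  | .pred _ _ => True
  | .rel _ _ => True
  | .eq _ _ => True
  | .neg φ => isBD φ
  | .and φ ψ => isBD φ ∧ isBD ψ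
  | .Kt _ _ => False
  | .K _ _ => False
  | .box _ φ => isBD φ

/-- Membership in the full language `L`. -/
def isL : Form Pred Cons → Prop
  | .pred _ _ => True
  | .rel _ _ => True
  | .eq _ _ => True
  | .neg φ => isL φ
  | .and φ ψ => isL φ ∧ isL ψ
  | .Kt _ _ => True
  | .K _ ψ => isBD ψ
  | .box _ φ => isL φ

/-- Membership in the static fragment `L⁻`: no movement modalities, and the
knowledge operator `K_z` is applied to `L_B`-formulas only. -/
def isStatic : Form Pred Cons → Prop
  | .pred _ _ => True
  | .rel _ _ => True
  | .eq _ _ => True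
  | .neg φ => isStatic φ
  | .and φ ψ => isStatic φ ∧ isStatic ψ
  | .Kt _ _ => True
  | .K _ φ => isBase φ
  | .box _ _ => False

/-- The variable `z` occurs in the formula. -/
def occurs (z : Var) : Form Pred Cons → Prop
  | .pred _ args => Term.var z ∈ args
  | .rel t₁ t₂ => t₁ = Term.var z ∨ t₂ = Term.var z
  | .eq t₁ t₂ => t₁ = Term.var z ∨ t₂ = Term.var z
  | .neg φ => occurs z φ
  | .and φ ψ => occurs z φ ∨ occurs z ψ
  | .Kt w t => w = z ∨ t = Term.var z
  | .K w φ => w = z ∨ occurs z φ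
  | .box w φ => w = z ∨ occurs z φ

/-- The list of terms occurring in a formula. -/
def termList : Form Pred Cons → List (Term Cons)
  | .pred _ args => args
  | .rel t₁ t₂ => [t₁, t₂]
  | .eq t₁ t₂ => [t₁, t₂]
  | .neg φ => termList φ
  | .and φ ψ => termList φ ++ termList ψ
  | .Kt _ t => [t]
  | .K _ φ => termList φ
  | .box _ φ => termList φ

end Form

/-- Substituting the constant `c` for the variable `z` in a term. -/
def Term.substC {Cons : Type} (c : Cons) (z : Var) : Term Cons → Term Cons
  | .var v => if v = z then .const c else .var v
  | .const c' => .const c'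

/-- `φ.substC c z` is `φ[c/z]`. -/
def Form.substC {Pred Cons : Type} (c : Cons) (z : Var) : Form Pred Cons → Form Pred Cons
  | .pred P args => .pred P (args.map (Term.substC c z))
  | .rel t₁ t₂ => .rel (t₁.substC c z) (t₂.substC c z)
  | .eq t₁ t₂ => .eq (t₁.substC c z) (t₂.substC c z)
  | .neg φ => .neg (φ.substC c z)
  | .and φ ψ => .and (φ.substC c z) (ψ.substC c z)
  | .Kt w t => .Kt w (t.substC c z)
  | .K w φ => .K w (φ.substC c z)
  | .box w φ => .box w (φ.substC c z)

/-- Replacing the term `t₂` by the term `t₁`. -/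
def Term.repl {Cons : Type} [DecidableEq Cons] (t₁ t₂ t : Term Cons) : Term Cons :=
  if t = t₂ then t₁ else t

/-- `φ.replace t₁ t₂` is `φ[t₁/t₂]`: the result of replacing `t₂` in `φ` with `t₁`. -/
def Form.replace {Pred Cons : Type} [DecidableEq Cons] (t₁ t₂ : Term Cons) :
    Form Pred Cons → Form Pred Cons
  | .pred P args => .pred P (args.map (Term.repl t₁ t₂))
  | .rel s₁ s₂ => .rel (Term.repl t₁ t₂ s₁) (Term.repl t₁ t₂ s₂)
  | .eq s₁ s₂ => .eq (Term.repl t₁ t₂ s₁) (Term.repl t₁ t₂ s₂)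
  | .neg φ => .neg (φ.replace t₁ t₂)
  | .and φ ψ => .and (φ.replace t₁ t₂) (ψ.replace t₁ t₂)
  | .Kt w t => .Kt w (Term.repl t₁ t₂ t)
  | .K w φ => .K w (φ.replace t₁ t₂)
  | .box w φ => .box w (φ.replace t₁ t₂)

/-- The list of all terms (constants and variables), for finite `Cons`. -/
noncomputable def allTerms (Cons : Type) [Fintype Cons] : List (Term Cons) :=
  (Finset.univ : Finset Cons).toList.map Term.const ++ [Term.var .x, Term.var .y]

/-- The syntactic distance formulas `D^n t₁ t₂`. -/
noncomputable def distForm (Pred : Type) {Cons : Type} [Fintype Cons] :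
    ℕ → Term Cons → Term Cons → Form Pred Cons
  | 0, t₁, t₂ => .eq t₁ t₂
  | n + 1, t₁, t₂ =>
      Form.or (distForm Pred n t₁ t₂)
        (Form.bigOr ((allTerms Cons).map fun t =>
          Form.and (distForm Pred n t₁ t) (Form.or (.rel t t₂) (.rel t₂ t))))

/-- `K_z z' = T`: the set `T` consists of the possible positions of `z'` considered by `z`. -/
noncomputable def KzEqSet {Pred Cons : Type} [Fintype Cons] [DecidableEq Cons]
    (z z' : Var) (T : Finset Cons) : Form Pred Cons :=
  Form.bigAnd
    ((T.toList.map fun c => Form.diaK z (.eq (.var z') (.const c))) ++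
      (Tᶜ.toList.map fun c => Form.K z (.neg (.eq (.var z') (.const c)))))

/-- `Rz = T`: `T` is exactly the set of (names of) R-successors of `z`. -/
noncomputable def RzEqSet {Pred Cons : Type} [Fintype Cons] [DecidableEq Cons]
    (z : Var) (T : Finset Cons) : Form Pred Cons :=
  Form.bigAnd
    ((T.toList.map fun c => Form.rel (.var z) (.const c)) ++
      (Tᶜ.toList.map fun c => Form.neg (Form.rel (.var z) (.const c))))

/-- The list of all subsets of `Cons`. -/
noncomputable def powList (Cons : Type) [Fintype Cons] [DecidableEq Cons] : List (Finset Cons) :=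
  (Finset.univ : Finset Cons).powerset.toList

/-! ### Semantics -/

/-- An interpretation of the vocabulary over a domain `D`. -/
structure Interp (Pred Cons D : Type) where
  pred : Pred → List D → Prop
  rel : D → D → Prop
  const : Cons → D

/-- Assignments (situations): positions of the two players. -/
abbrev Assign (D : Type) := Var → D

/-- The value of a term at an interpretation and a situation. -/
def Term.val {Pred Cons D : Type} (I : Interp Pred Cons D) (σ : Assign D) :
    Term Cons → D
  | .const c => I.const c
  | .var v => σ v

/-- `Dball I m s` is `D^m(s)`: points reachable from `s` in at most `m` steps
along `I.rel` or its converse. -/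
def Dball {Pred Cons D : Type} (I : Interp Pred Cons D) : ℕ → D → Set D
  | 0, s => {s}
  | m + 1, s => Dball I m s ∪ {t | ∃ u ∈ Dball I m s, I.rel u t ∨ I.rel t u}

/-- `R^z σ σ'`: player `z` moves along an arrow, the other player stays put. -/
def Rstep {Pred Cons D : Type} (I : Interp Pred Cons D) (z : Var) (σ σ' : Assign D) : Prop :=
  I.rel (σ z) (σ' z) ∧ σ z.other = σ' z.other

/-- Indistinguishability data: a relation on assignments for each player. -/
abbrev SimRel (D : Type) := Var → Assign D → Assign D → Prop

/-- `Σ|σ`: the situations related to `σ` by some player's indistinguishability. -/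
def restrict {D : Type} (Sit : Set (Assign D)) (sim : SimRel D) (σ : Assign D) :
    Set (Assign D) :=
  {σ' ∈ Sit | ∃ z, sim z σ σ'}

/-- The updated set of situations after player `z` moves from `σ₁` to `σ₂`. -/
def updSit {Pred Cons D : Type} (k : ℕ) (I : Interp Pred Cons D)
    (Sit : Set (Assign D)) (sim : SimRel D) (z : Var) (σ₁ σ₂ : Assign D) :
    Set (Assign D) :=
  {σ' | (σ₂ Var.x ∈ Dball I k (σ₂ Var.y) ∧ σ' = σ₂) ∨
        (σ₂ Var.x ∉ Dball I k (σ₂ Var.y) ∧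
          (∃ σ ∈ restrict Sit sim σ₁, Rstep I z σ σ') ∧
          σ' Var.x ∉ Dball I k (σ' Var.y))}

/-- The updated indistinguishability relations: `σ₁ ∼'_z σ₂` iff `σ₁ z = σ₂ z`. -/
def updSim (D : Type) : SimRel D := fun z σ₁ σ₂ => σ₁ z = σ₂ z

/-- Satisfaction for `ELCR` (with sight `k`). -/
def Sat {Pred Cons D : Type} (k : ℕ) (I : Interp Pred Cons D) :
    Set (Assign D) → SimRel D → Assign D → Form Pred Cons → Prop
  | _, _, σ, .pred P args => I.pred P (args.map (Term.val I σ))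
  | _, _, σ, .rel t₁ t₂ => I.rel (t₁.val I σ) (t₂.val I σ)
  | _, _, σ, .eq t₁ t₂ => t₁.val I σ = t₂.val I σ
  | Sit, sim, σ, .neg φ => ¬ Sat k I Sit sim σ φ
  | Sit, sim, σ, .and φ ψ => Sat k I Sit sim σ φ ∧ Sat k I Sit sim σ ψ
  | Sit, sim, σ, .Kt z t => ∀ σ' ∈ Sit, sim z σ' σ → t.val I σ = t.val I σ'
  | Sit, sim, σ, .K z φ => ∀ σ' ∈ Sit, sim z σ' σ → Sat k I Sit sim σ' φ
  | Sit, sim, σ, .box z φ => ∀ σ₂, Rstep I z σ σ₂ →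
      Sat k I (updSit k I Sit sim z σ σ₂) (updSim D) σ₂ φ

/-- The conditions making `(D, I, Σ, ∼)` a model: seriality of `I.rel`, every
point named by a constant, `Σ` nonempty, and each `∼_z` an equivalence relation on `Σ`. -/
structure IsModel {Pred Cons D : Type} (I : Interp Pred Cons D)
    (Sit : Set (Assign D)) (sim : SimRel D) : Prop where
  serial : ∀ s, ∃ t, I.rel s t
  const_surj : Function.Surjective I.const
  nonempty : Sit.Nonempty
  sim_mem : ∀ z σ σ', sim z σ σ' → σ ∈ Sit ∧ σ' ∈ Sit
  sim_refl : ∀ z, ∀ σ ∈ Sit, sim z σ σ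
  sim_symm : ∀ z σ σ', sim z σ σ' → sim z σ' σ
  sim_trans : ∀ z σ₁ σ₂ σ₃, sim z σ₁ σ₂ → sim z σ₂ σ₃ → sim z σ₁ σ₃

/-- The `k`-sight condition. -/
def KSight {Pred Cons D : Type} (k : ℕ) (I : Interp Pred Cons D)
    (Sit : Set (Assign D)) (sim : SimRel D) : Prop :=
  ∀ z σ σ', σ ∈ Sit → σ' ∈ Sit → sim z σ σ' →
    ∀ z', σ z' ∈ Dball I k (σ z) → σ z' = σ' z'

/-- A nonempty conjunction `K_zα₁ ∧ ⋯ ∧ K_zαₙ ∧ ⟨K_z⟩β₁ ∧ ⋯ ∧ ⟨K_z⟩βₘ`. -/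
def kConj {Pred Cons : Type} (z : Var) (αs βs : List (Form Pred Cons)) :
    Form Pred Cons :=
  Form.bigAnd (αs.map (Form.K z) ++ βs.map (Form.diaK z))
/-- The right-hand side of the reduction axiom (R5). -/
noncomputable def r5rhs (Pred : Type) {Cons : Type} [Fintype Cons] [DecidableEq Cons]
    (k : ℕ) (z : Var) : Form Pred Cons :=
  Form.or (Form.Kt z (Term.var z.other))
    (Form.bigAnd ((powList Cons).flatMap fun T => (powList Cons).map fun T₁ =>
      ((KzEqSet z z.other T).and (RzEqSet z T₁)).imp
        (Form.bigAnd (T₁.toList.map fun a =>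
          Form.or (distForm Pred k (Term.const a) (Term.var z.other))
            (Form.bigAnd (T.toList.map fun b =>
              (Form.neg (Form.eq (Term.const b) (Term.var z.other))).imp
                (distForm Pred k (Term.const a) (Term.const b))))))))

section Satisfaction

variable {Pred Cons D : Type} {k : ℕ} {I : Interp Pred Cons D} {Sit : Set (Assign D)}
  {sim : SimRel D} {σ : Assign D}

theorem sat_or {φ ψ : Form Pred Cons} :
    Sat k I Sit sim σ (φ.or ψ) ↔ Sat k I Sit sim σ φ ∨ Sat k I Sit sim σ ψ := by
  simp only [Form.or, Sat]
  tauto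

theorem sat_imp {φ ψ : Form Pred Cons} :
    Sat k I Sit sim σ (φ.imp ψ) ↔ (Sat k I Sit sim σ φ → Sat k I Sit sim σ ψ) := by
  simp only [Form.imp, Sat]
  tauto

theorem sat_diaK {z : Var} {φ : Form Pred Cons} :
    Sat k I Sit sim σ (Form.diaK z φ) ↔ ∃ τ ∈ Sit, sim z τ σ ∧ Sat k I Sit sim τ φ := by
  simp [Form.diaK, Sat]

theorem sat_bigAnd {l : List (Form Pred Cons)} :
    Sat k I Sit sim σ (Form.bigAnd l) ↔ ∀ φ ∈ l, Sat k I Sit sim σ φ := by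
  induction l with
  | nil => simp [Form.bigAnd, Form.trueF, Form.falseF, Sat]
  | cons φ l ih => simp [Form.bigAnd, Sat, ih]

theorem sat_bigOr {l : List (Form Pred Cons)} :
    Sat k I Sit sim σ (Form.bigOr l) ↔ ∃ φ ∈ l, Sat k I Sit sim σ φ := by
  induction l with
  | nil => simp [Form.bigOr, Form.falseF, Sat]
  | cons φ l ih => simp [Form.bigOr, sat_or, ih]

theorem mem_allTerms [Fintype Cons] (t : Term Cons) : t ∈ allTerms Cons := by
  rcases t with c | v
  · simp [allTerms]
  · cases v <;> simp [allTerms]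

theorem sat_distForm [Fintype Cons] (hI : Function.Surjective I.const) (n : ℕ)
    (t₁ t₂ : Term Cons) :
    Sat k I Sit sim σ (distForm Pred n t₁ t₂) ↔ t₂.val I σ ∈ Dball I n (t₁.val I σ) := by
  induction n generalizing t₂ with
  | zero => simp [distForm, Sat, Dball, eq_comm]
  | succ n ih =>
    simp only [distForm, sat_or, sat_bigOr, ih, Dball, List.mem_map, Set.mem_union,
      Set.mem_ofPred_eq]
    refine or_congr Iff.rfl ⟨?_, ?_⟩
    · rintro ⟨_, ⟨t, -, rfl⟩, h⟩
      simp only [Sat, sat_or, ih] at h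
      exact ⟨_, h⟩
    · rintro ⟨u, hu⟩
      obtain ⟨c, rfl⟩ := hI u
      refine ⟨_, ⟨.const c, mem_allTerms _, rfl⟩, ?_⟩
      simp only [Sat, sat_or, ih]
      exact hu

theorem sat_KzEqSet [Fintype Cons] [DecidableEq Cons] {z z' : Var} {T : Finset Cons} :
    Sat k I Sit sim σ (KzEqSet z z' T) ↔
      ∀ c, c ∈ T ↔ ∃ τ ∈ Sit, sim z τ σ ∧ τ z' = I.const c := by
  simp only [KzEqSet, sat_bigAnd, List.forall_mem_append, List.forall_mem_map,
    Finset.mem_toList, Finset.mem_compl, sat_diaK, Sat, Term.val]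
  refine ⟨fun h c => ⟨h.1 c, fun ⟨τ, hτ, hs, he⟩ => ?_⟩,
    fun h => ⟨fun c => (h c).1, fun c hc τ hτ hs he => hc ((h c).2 ⟨τ, hτ, hs, he⟩)⟩⟩
  by_contra hc
  exact h.2 c hc τ hτ hs he

theorem sat_RzEqSet [Fintype Cons] [DecidableEq Cons] {z : Var} {T : Finset Cons} :
    Sat k I Sit sim σ (RzEqSet z T) ↔ ∀ c, c ∈ T ↔ I.rel (σ z) (I.const c) := by
  simp only [RzEqSet, sat_bigAnd, List.forall_mem_append, List.forall_mem_map,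
    Finset.mem_toList, Finset.mem_compl, Sat, Term.val]
  refine ⟨fun h c => ⟨h.1 c, not_imp_not.1 (h.2 c)⟩,
    fun h => ⟨fun c => (h c).1, fun c => mt (h c).2⟩⟩

end Satisfaction

section Dball

variable {Pred Cons D : Type} {I : Interp Pred Cons D}

theorem self_mem_Dball (n : ℕ) (s : D) : s ∈ Dball I n s := by
  induction n with
  | zero => rfl
  | succ n ih => exact Or.inl ih

theorem mem_Dball_succ_of_adj {n : ℕ} {s u t : D} (hsu : I.rel s u ∨ I.rel u s)
    (h : t ∈ Dball I n u) : t ∈ Dball I (n + 1) s := by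
  induction n generalizing t with
  | zero => exact Or.inr ⟨s, rfl, (h : t = u) ▸ hsu⟩
  | succ n ih =>
    rcases h with h | ⟨v, hv, hvt⟩
    · exact Or.inl (ih h)
    · exact Or.inr ⟨v, ih hv, hvt⟩

theorem mem_Dball_symm {n : ℕ} {s t : D} (h : t ∈ Dball I n s) : s ∈ Dball I n t := by
  induction n generalizing t with
  | zero => exact (h : t = s).symm
  | succ n ih =>
    rcases h with h | ⟨u, hu, hut⟩
    · exact Or.inl (ih h)
    · exact mem_Dball_succ_of_adj hut.symm (ih hu)

theorem x_mem_Dball_y_iff {n : ℕ} (z : Var) (σ : Assign D) :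
    σ .x ∈ Dball I n (σ .y) ↔ σ z.other ∈ Dball I n (σ z) := by
  cases z
  · exact ⟨mem_Dball_symm, mem_Dball_symm⟩
  · rfl

end Dball

theorem Var.other_ne (z : Var) : z.other ≠ z := by
  cases z <;> simp [Var.other]

theorem Var.eq_or_eq_other (w z : Var) : w = z ∨ w = z.other := by
  cases w <;> cases z <;> simp [Var.other]

section Reduction

variable {Pred Cons D : Type} {k : ℕ} {I : Interp Pred Cons D} {Sit : Set (Assign D)}
  {sim : SimRel D} {σ : Assign D}

/-- After any move of `z`, the other player is either seen from the new position, or every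
alternative position considered possible by `z` before the move is. -/
theorem sat_box_Kt_other_iff (hM : IsModel I Sit sim) (hK : KSight k I Sit sim)
    (hσ : σ ∈ Sit) (z : Var) :
    Sat k I Sit sim σ (Form.box z (Form.Kt z (Term.var z.other))) ↔
      ∀ a, I.rel (σ z) a → σ z.other ∈ Dball I k a ∨
        ∀ τ ∈ Sit, sim z τ σ → τ z.other ≠ σ z.other → τ z.other ∈ Dball I k a := by
  simp only [Sat, Term.val, updSim]
  constructor
  · intro h a ha
    rw [or_iff_not_imp_left]
    intro hvis τ hτ hs hne
    by_contra hτa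
    have hz : (Function.update σ z a) z = a := Function.update_self ..
    have ho : (Function.update σ z a) z.other = σ z.other :=
      Function.update_of_ne z.other_ne ..
    have hz' : (Function.update τ z a) z = a := Function.update_self ..
    have ho' : (Function.update τ z a) z.other = τ z.other :=
      Function.update_of_ne z.other_ne ..
    have hτz : τ z = σ z := hK z τ σ hτ hσ hs z (self_mem_Dball k _)
    have key := h (Function.update σ z a) ⟨by rwa [hz], ho.symm⟩ (Function.update τ z a)
      (Or.inr ⟨?_, ⟨τ, ⟨hτ, z, hM.sim_symm _ _ _ hs⟩, ?_, ho'.symm⟩, ?_⟩) (hz'.trans hz.symm)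
    · exact hne (by rw [← ho', ← key, ho])
    · rwa [x_mem_Dball_y_iff z, hz, ho]
    · rwa [hz', hτz]
    · rwa [x_mem_Dball_y_iff z, hz', ho']
  · rintro h σ₂ ⟨hrel, ho⟩ σ' (⟨-, rfl⟩ | ⟨hvis, ⟨τ, ⟨hτ, w, hw⟩, hτrel, hτo⟩, hvis'⟩) heq
    · rfl
    rw [x_mem_Dball_y_iff z] at hvis hvis'
    rw [← ho, ← hτo]
    rcases w.eq_or_eq_other z with rfl | rfl
    · by_contra hne
      rcases h _ hrel with h | h
      · exact hvis (ho ▸ h)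
      · refine hvis' ?_
        rw [← hτo, heq]
        exact h τ hτ (hM.sim_symm _ _ _ hw) (Ne.symm hne)
    · exact hK _ σ τ hσ hτ hw _ (self_mem_Dball k _)

theorem sat_r5rhs_iff [Fintype Cons] [DecidableEq Cons] (hI : Function.Surjective I.const)
    (z : Var) :
    Sat k I Sit sim σ (r5rhs Pred k z) ↔
      ∀ a, I.rel (σ z) a → σ z.other ∈ Dball I k a ∨
        ∀ τ ∈ Sit, sim z τ σ → τ z.other ≠ σ z.other → τ z.other ∈ Dball I k a := by
  classical
  simp only [r5rhs, sat_or, sat_bigAnd, List.mem_flatMap, List.mem_map, powList,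
    Finset.mem_toList, Finset.mem_powerset, Finset.subset_univ, true_and]
  constructor
  · rintro (h | h) a ha
    · simp only [Sat, Term.val] at h
      exact Or.inr fun τ hτ hs hne => absurd (h τ hτ hs).symm hne
    obtain ⟨a, rfl⟩ := hI a
    have h' := h _ ⟨Finset.univ.filter fun c => ∃ τ ∈ Sit, sim z τ σ ∧ τ z.other = I.const c,
      Finset.univ.filter fun c => I.rel (σ z) (I.const c), rfl⟩
    simp only [sat_imp, Sat, sat_KzEqSet, sat_RzEqSet, sat_bigAnd, List.forall_mem_map,
      Finset.mem_toList, Finset.mem_filter_univ, sat_or, sat_distForm hI, Term.val,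
      implies_true, and_self, true_imp_iff] at h'
    refine (h' a ha).imp_right fun hb τ hτ hs hne => ?_
    obtain ⟨b, hbτ⟩ := hI (τ z.other)
    exact hbτ ▸ hb b ⟨τ, hτ, hs, hbτ.symm⟩ (hbτ ▸ hne)
  · rintro h
    refine Or.inr ?_
    rintro _ ⟨T, T₁, rfl⟩
    simp only [sat_imp, Sat, sat_KzEqSet, sat_RzEqSet, sat_bigAnd, List.forall_mem_map,
      Finset.mem_toList, sat_or, sat_distForm hI, Term.val]
    rintro ⟨hT, hT₁⟩ a ha
    refine (h _ ((hT₁ a).1 ha)).imp_right fun hb b hbT hne => ?_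
    obtain ⟨τ, hτ, hs, he⟩ := (hT b).1 hbT
    exact he ▸ hb τ hτ hs (he ▸ hne)

end Reduction

/-- The reduction schema (R5) is valid on `k`-sight models:
`[z]K_z z' ↔ (K_z z' ∨ ⋀_{T,T₁⊆Cons}(K_z z'=T ∧ Rz=T₁ → ⋀_{a∈T₁}(D^k a z' ∨
⋀_{b∈T}(¬b≡z' → D^k a b))))`. -/
theorem r5_valid {Pred Cons : Type} [Fintype Cons] [DecidableEq Cons]
    [Nonempty Cons] (k : ℕ) (D : Type) [Finite D] (I : Interp Pred Cons D)
    (Sit : Set (Assign D)) (sim : SimRel D)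
    (hM : IsModel I Sit sim) (hK : KSight k I Sit sim)
    (σ : Assign D) (hσ : σ ∈ Sit) (z : Var) :
    Sat k I Sit sim σ (Form.box z (Form.Kt z (Term.var z.other))) ↔
      Sat k I Sit sim σ (r5rhs Pred k z) := by
  exact (sat_box_Kt_other_iff hM hK hσ z).trans (sat_r5rhs_iff hM.const_surj z).symm
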